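/- Let (R,m) be a Noetherian local commutative ring of prime characteristic p with depth R = d > 0, let y = y_1, ..., y_d be a maximal R-regular sequence in m, and let c_y(R) be the smallest positive integer s such that, in the quotient ring R̄ = R/(y_1,...,y_d) with maximal ideal m̄, the socle (0:m̄)_{R̄} is not contained in m̄^s. Let M be a finitely generated R-module. If for some integers n ≥ 1 and r with p^r > c_y(R) one has Tor^R_j(M, ^{φ^r}R) = 0 for all j with n ≤ j ≤ n + d, then M has finite projective dimension. -/

import Mathlib

open CategoryTheory

universe u

/-- `R` viewed as a module over itself by restriction of scalars along a ring
endomorphism `f : R →+* R` (here `f` will be the `r`-th Frobenius power `a ↦ a ^ p ^ r`),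
i.e. the module `^{φ^r}R` with action `a · b = f a * b = a ^ p ^ r * b`. -/
noncomputable abbrev frobMod {R : Type u} [CommRing R] (f : R →+* R) : ModuleCat.{u} R :=
  (ModuleCat.restrictScalars f).obj (ModuleCat.of R R)

/-- An `R`-module `M` has projective dimension `< j` if it admits a projective
resolution `P_•` with `P_n = 0` for all `n ≥ j`. -/
def HasProjDimLT (R : Type u) [CommRing R] (M : Type u) [AddCommGroup M] [Module R M]
    (j : ℕ) : Prop :=
  ∃ P : ProjectiveResolution (ModuleCat.of R M),
    ∀ n, j ≤ n → Limits.IsZero (P.complex.X n)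

open TensorProduct in
theorem exists_lTensor_eq_of_exact {R K F M A B C D : Type*} [CommRing R]
    [AddCommGroup K] [Module R K] [AddCommGroup F] [Module R F] [AddCommGroup M] [Module R M]
    [AddCommGroup A] [Module R A] [AddCommGroup B] [Module R B] [AddCommGroup C] [Module R C]
    [AddCommGroup D] [Module R D] [Module.Flat R F] [Module.Flat R C]
    {i : K →ₗ[R] F} {q : F →ₗ[R] M} (hi : Function.Injective i) (hiq : Function.Exact i q)
    (hq : Function.Surjective q) {a : A →ₗ[R] B} {b : B →ₗ[R] C} {c : C →ₗ[R] D}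
    (hab : b ∘ₗ a = 0) (hbc : Function.Exact b c)
    (hM : Function.Exact (a.lTensor M) (b.lTensor M))
    (x : K ⊗[R] C) (hx : c.lTensor F (i.rTensor C x) = 0) : ∃ y, b.lTensor K y = x := by
  obtain ⟨z, hz⟩ := (Module.Flat.lTensor_exact F hbc _).1 hx
  have h1 : b.lTensor M (q.rTensor B z) = 0 := by
    have : q.rTensor C (b.lTensor F z) = 0 := by
      rw [hz]
      exact (rTensor_exact C hiq hq).apply_apply_eq_zero x
    rwa [← LinearMap.comp_apply, LinearMap.rTensor_comp_lTensor,
      ← LinearMap.lTensor_comp_rTensor] at this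
  obtain ⟨w, hw⟩ := (hM _).1 h1
  obtain ⟨w, rfl⟩ := LinearMap.rTensor_surjective A hq w
  have h2 : q.rTensor B (z - a.lTensor F w) = 0 := by
    rw [map_sub, ← hw, sub_eq_zero, ← LinearMap.comp_apply, ← LinearMap.comp_apply,
      LinearMap.rTensor_comp_lTensor, ← LinearMap.lTensor_comp_rTensor]
  obtain ⟨y, hy⟩ := (rTensor_exact B hiq hq _).1 h2
  refine ⟨y, Module.Flat.rTensor_preserves_injective_linearMap i hi ?_⟩
  rw [← LinearMap.comp_apply, LinearMap.rTensor_comp_lTensor, ← LinearMap.lTensor_comp_rTensor,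
    LinearMap.comp_apply, hy, map_sub, hz, ← LinearMap.comp_apply (b.lTensor F),
    ← LinearMap.lTensor_comp, hab, LinearMap.lTensor_zero, LinearMap.zero_apply, sub_zero]

theorem exact_lTensor_of_exact {R K F M A B C D : Type*} [CommRing R]
    [AddCommGroup K] [Module R K] [AddCommGroup F] [Module R F] [AddCommGroup M] [Module R M]
    [AddCommGroup A] [Module R A] [AddCommGroup B] [Module R B] [AddCommGroup C] [Module R C]
    [AddCommGroup D] [Module R D] [Module.Flat R F] [Module.Flat R C]
    {i : K →ₗ[R] F} {q : F →ₗ[R] M} (hi : Function.Injective i) (hiq : Function.Exact i q)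
    (hq : Function.Surjective q) {a : A →ₗ[R] B} {b : B →ₗ[R] C} {c : C →ₗ[R] D}
    (hab : b ∘ₗ a = 0) (hbc : Function.Exact b c)
    (hM : Function.Exact (a.lTensor M) (b.lTensor M)) :
    Function.Exact (b.lTensor K) (c.lTensor K) := by
  intro x
  constructor
  · intro hx
    refine exists_lTensor_eq_of_exact hi hiq hq hab hbc hM x ?_
    rw [← LinearMap.comp_apply, LinearMap.lTensor_comp_rTensor, ← LinearMap.rTensor_comp_lTensor,
      LinearMap.comp_apply, hx, map_zero]
  · rintro ⟨y, rfl⟩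
    rw [← LinearMap.comp_apply, ← LinearMap.lTensor_comp, hbc.linearMap_comp_eq_zero,
      LinearMap.lTensor_zero, LinearMap.zero_apply]

theorem rTensor_injective_of_exact {R K F M A B C D : Type*} [CommRing R]
    [AddCommGroup K] [Module R K] [AddCommGroup F] [Module R F] [AddCommGroup M] [Module R M]
    [AddCommGroup A] [Module R A] [AddCommGroup B] [Module R B] [AddCommGroup C] [Module R C]
    [AddCommGroup D] [Module R D] [Module.Flat R F] [Module.Flat R C]
    {i : K →ₗ[R] F} {q : F →ₗ[R] M} (hi : Function.Injective i) (hiq : Function.Exact i q)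
    (hq : Function.Surjective q) {a : A →ₗ[R] B} {b : B →ₗ[R] C} {c : C →ₗ[R] D}
    (hab : b ∘ₗ a = 0) (hbc : Function.Exact b c) (hc : Function.Surjective c)
    (hM : Function.Exact (a.lTensor M) (b.lTensor M)) :
    Function.Injective (i.rTensor D) := by
  rw [injective_iff_map_eq_zero]
  intro x hx
  obtain ⟨x, rfl⟩ := LinearMap.lTensor_surjective K hc x
  obtain ⟨y, rfl⟩ := exists_lTensor_eq_of_exact hi hiq hq hab hbc hM x (by
    rwa [← LinearMap.comp_apply, LinearMap.lTensor_comp_rTensor,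
      ← LinearMap.rTensor_comp_lTensor])
  rw [← LinearMap.comp_apply, ← LinearMap.lTensor_comp, hbc.linearMap_comp_eq_zero,
    LinearMap.lTensor_zero, LinearMap.zero_apply]

/-- Balancing of `Tor` for flat resolutions: if `P` resolves `N` and `F` resolves `M`, then
exactness of `M ⊗ P` in degree `j + 1` implies exactness of `F ⊗ N` in degree `j + 1`. -/
theorem exact_rTensor_of_exact_lTensor {R N : Type u} [CommRing R] [AddCommGroup N] [Module R N]
    {P : ℕ → Type u} [∀ i, AddCommGroup (P i)] [∀ i, Module R (P i)] [∀ i, Module.Flat R (P i)]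
    {e : ∀ i, P (i + 1) →ₗ[R] P i} {η : P 0 →ₗ[R] N} (he : ∀ i, Function.Exact (e (i + 1)) (e i))
    (heη : Function.Exact (e 0) η) (hη : Function.Surjective η) (j : ℕ) :
    ∀ {M : Type u} [AddCommGroup M] [Module R M]
      {F : ℕ → Type u} [∀ i, AddCommGroup (F i)] [∀ i, Module R (F i)] [∀ i, Module.Flat R (F i)]
      {δ : ∀ i, F (i + 1) →ₗ[R] F i} {ε : F 0 →ₗ[R] M}
      (_ : ∀ i, Function.Exact (δ (i + 1)) (δ i)) (_ : Function.Exact (δ 0) ε)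
      (_ : Function.Surjective ε)
      (_ : Function.Exact ((e (j + 1)).lTensor M) ((e j).lTensor M)),
      Function.Exact ((δ (j + 1)).rTensor N) ((δ j).rTensor N) := by
  induction j with
  | zero =>
    intro M _ _ F _ _ _ δ ε hδ hδε hε h
    have hinj := rTensor_injective_of_exact (LinearMap.ker ε).subtype_injective
      (LinearMap.exact_subtype_ker_map ε) hε (he 0).linearMap_comp_eq_zero heη hη h
    let q : F 1 →ₗ[R] LinearMap.ker ε :=
      (δ 0).codRestrict (LinearMap.ker ε) fun x => hδε.apply_apply_eq_zero x
    have hq : Function.Surjective q := fun x => by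
      obtain ⟨y, hy⟩ := (hδε x.1).1 x.2
      exact ⟨y, Subtype.ext hy⟩
    have hδq : Function.Exact (δ 1) q := fun x =>
      ⟨fun hx => (hδ 0 x).1 (congrArg Subtype.val hx), fun hx => Subtype.ext ((hδ 0 x).2 hx)⟩
    have hd : δ 0 = (LinearMap.ker ε).subtype ∘ₗ q := rfl
    rw [hd, LinearMap.rTensor_comp]
    intro x
    rw [LinearMap.comp_apply, map_eq_zero_iff _ hinj]
    exact rTensor_exact N hδq hq x
  | succ j ih =>
    intro M _ _ F _ _ _ δ ε hδ hδε hε h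
    have hex := exact_lTensor_of_exact (LinearMap.ker ε).subtype_injective
      (LinearMap.exact_subtype_ker_map ε) hε (he (j + 1)).linearMap_comp_eq_zero (he j) h
    let q : F 1 →ₗ[R] LinearMap.ker ε :=
      (δ 0).codRestrict (LinearMap.ker ε) fun x => hδε.apply_apply_eq_zero x
    have hq : Function.Surjective q := fun x => by
      obtain ⟨y, hy⟩ := (hδε x.1).1 x.2
      exact ⟨y, Subtype.ext hy⟩
    have hδq : Function.Exact (δ 1) q := fun x =>
      ⟨fun hx => (hδ 0 x).1 (congrArg Subtype.val hx), fun hx => Subtype.ext ((hδ 0 x).2 hx)⟩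
    exact ih (F := fun i => F (i + 1)) (δ := fun i => δ (i + 1)) (fun i => hδ (i + 1)) hδq hq hex

/-- A finite module over a local ring has a free cover with kernel in `m • ⊤`. -/
theorem exists_minimal_cover {R M : Type*} [CommRing R] [IsLocalRing R] [AddCommGroup M]
    [Module R M] [Module.Finite R M] :
    ∃ (a : ℕ) (g : (Fin a → R) →ₗ[R] M), Function.Surjective g ∧
      ∀ x, g x = 0 → ∀ k, x k ∈ IsLocalRing.maximalIdeal R := by
  suffices H : ∀ (a : ℕ) (g : (Fin a → R) →ₗ[R] M), Function.Surjective g →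
      ∃ (b : ℕ) (g : (Fin b → R) →ₗ[R] M), Function.Surjective g ∧
        ∀ x, g x = 0 → ∀ k, x k ∈ IsLocalRing.maximalIdeal R by
    obtain ⟨a, g, hg⟩ := Module.Finite.exists_fin' R M
    exact H a g hg
  intro a
  induction a with
  | zero => exact fun g hg => ⟨0, g, hg, fun _ _ k => k.elim0⟩
  | succ a ih =>
    intro g hg
    by_cases hm : ∀ x, g x = 0 → ∀ k, x k ∈ IsLocalRing.maximalIdeal R
    · exact ⟨a + 1, g, hg, hm⟩
    · push Not at hm
      obtain ⟨x, hx, k, hk⟩ := hm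
      rw [IsLocalRing.mem_maximalIdeal, mem_nonunits_iff, not_not] at hk
      obtain ⟨t, ht⟩ := hk.exists_left_inv
      refine ih (g ∘ₗ Function.ExtendByZero.linearMap R k.succAbove) fun m => ?_
      obtain ⟨y, rfl⟩ := hg m
      refine ⟨fun i => (y - (y k * t) • x) (k.succAbove i), ?_⟩
      have : Function.ExtendByZero.linearMap R k.succAbove
          (fun i => (y - (y k * t) • x) (k.succAbove i)) = y - (y k * t) • x := by
        ext i
        obtain rfl | ⟨i, rfl⟩ := Fin.eq_self_or_eq_succAbove k i
        · simp [mul_assoc, ht]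
        · simp [Fin.succAbove_right_injective.extend_apply]
      rw [LinearMap.comp_apply, this, map_sub, map_smul, hx, smul_zero, sub_zero]

/-- A finite module over a Noetherian local ring has a minimal free resolution. -/
theorem exists_minimal_resolution (R : Type u) [CommRing R] [IsNoetherianRing R] [IsLocalRing R]
    (M : Type u) [AddCommGroup M] [Module R M] [Module.Finite R M] :
    ∃ (a : ℕ → ℕ) (δ : ∀ i, (Fin (a (i + 1)) → R) →ₗ[R] (Fin (a i) → R))
      (ε : (Fin (a 0) → R) →ₗ[R] M),
      (∀ i, Function.Exact (δ (i + 1)) (δ i)) ∧ Function.Exact (δ 0) ε ∧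
      Function.Surjective ε ∧ ∀ i x k, δ i x k ∈ IsLocalRing.maximalIdeal R := by
  obtain ⟨a₀, ε, hε, hε'⟩ := exists_minimal_cover (R := R) (M := M)
  have step : ∀ {a : ℕ} {X : Type u} [AddCommGroup X] [Module R X] (g : (Fin a → R) →ₗ[R] X),
      ∃ (b : ℕ) (h : (Fin b → R) →ₗ[R] (Fin a → R)), Function.Exact h g ∧
        ∀ x, h x = 0 → ∀ k, x k ∈ IsLocalRing.maximalIdeal R := by
    intro a X _ _ g
    obtain ⟨b, h, hh, hh'⟩ := exists_minimal_cover (R := R) (M := LinearMap.ker g)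
    refine ⟨b, (LinearMap.ker g).subtype ∘ₗ h, fun x => ⟨fun hx => ?_, ?_⟩,
      fun x hx => hh' x (Subtype.ext hx)⟩
    · obtain ⟨y, hy⟩ := hh ⟨x, hx⟩
      exact ⟨y, congrArg Subtype.val hy⟩
    · rintro ⟨y, rfl⟩
      exact (h y).2
  choose nb nh hex hmin using @step
  let S := Σ a b : ℕ, (Fin a → R) →ₗ[R] (Fin b → R)
  let s : ℕ → S := fun i => Nat.rec ⟨nb ε, a₀, nh ε⟩ (fun _ t => ⟨nb t.2.2, t.1, nh t.2.2⟩) i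
  refine ⟨fun i => (s i).2.1, fun i => (s i).2.2, ε, fun i => hex (s i).2.2, hex ε, hε, ?_⟩
  rintro (_ | i) x
  · exact hε' _ ((hex ε).apply_apply_eq_zero x)
  · cases i with
    | zero => exact hmin ε _ ((hex (nh ε)).apply_apply_eq_zero x)
    | succ i => exact hmin (s i).2.2 _ ((hex (s (i + 1)).2.2).apply_apply_eq_zero x)

theorem exists_projectiveResolution {R : Type u} [CommRing R] {M : Type u} [AddCommGroup M]
    [Module R M] {F : ℕ → Type u} [∀ i, AddCommGroup (F i)] [∀ i, Module R (F i)]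
    [∀ i, Module.Projective R (F i)]
    {δ : ∀ i, F (i + 1) →ₗ[R] F i} {ε : F 0 →ₗ[R] M}
    (hδ : ∀ i, Function.Exact (δ (i + 1)) (δ i)) (hδε : Function.Exact (δ 0) ε)
    (hε : Function.Surjective ε) :
    ∃ P : ProjectiveResolution (ModuleCat.of R M), ∀ i, P.complex.X i = ModuleCat.of R (F i) := by
  let K : ChainComplex (ModuleCat.{u} R) ℕ :=
    ChainComplex.of (fun i => ModuleCat.of R (F i)) (fun i => ModuleCat.ofHom (δ i)) fun i => by
      rw [← ModuleCat.ofHom_comp, (hδ i).linearMap_comp_eq_zero]; rfl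
  have hd (i : ℕ) : K.d (i + 1) i = ModuleCat.ofHom (δ i) := by
    simp [K]
  have hK (i : ℕ) : K.ExactAt (i + 1) := by
    rw [HomologicalComplex.exactAt_iff' _ (i + 1 + 1) (i + 1) i (by simp) (by simp),
      ShortComplex.moduleCat_exact_iff]
    intro x hx
    obtain ⟨y, hy⟩ := (hδ i x).1 (by
      have : K.d (i + 1) i x = 0 := hx
      rwa [hd] at this)
    refine ⟨y, ?_⟩
    change K.d (i + 1 + 1) (i + 1) y = x
    rw [hd]; exact hy
  have hKε : K.d 1 0 ≫ ModuleCat.ofHom ε = 0 := by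
    rw [hd, ← ModuleCat.ofHom_comp, hδε.linearMap_comp_eq_zero]; rfl
  refine ⟨{ complex := K
            projective := fun i => (IsProjective.iff_projective _).1
              (inferInstanceAs (Module.Projective R (F i)))
            π := (ChainComplex.toSingle₀Equiv _ _).symm ⟨ModuleCat.ofHom ε, hKε⟩
            quasiIso := ⟨fun i => ?_⟩ }, fun i => rfl⟩
  cases i with
  | zero =>
    rw [ChainComplex.quasiIsoAt₀_iff, ShortComplex.quasiIso_iff_of_zeros']
    · refine (ShortComplex.exact_and_epi_g_iff_of_iso
        (S₂ := ShortComplex.mk (K.d 1 0) (ModuleCat.ofHom ε) hKε) ?_).2 ⟨?_, ?_⟩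
      · exact ShortComplex.isoMk (Iso.refl _) (Iso.refl _) (Iso.refl _)
          ((Category.id_comp (K.d 1 0)).trans (Category.comp_id (K.d 1 0)).symm)
          ((Category.id_comp (ModuleCat.ofHom ε)).trans
            (Category.comp_id (ModuleCat.ofHom ε)).symm)
      · rw [ShortComplex.moduleCat_exact_iff]
        intro x hx
        obtain ⟨y, hy⟩ := (hδε x).1 hx
        refine ⟨y, ?_⟩
        change K.d 1 0 y = x
        rw [hd]; exact hy
      · exact (ModuleCat.epi_iff_surjective _).2 hε
    all_goals rfl
  | succ i =>
    rw [quasiIsoAt_iff_exactAt']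
    · exact hK i
    · apply ChainComplex.exactAt_succ_single_obj

open MonoidalCategory in
theorem exact_lTensor_of_subsingleton_tor {R : Type u} [CommRing R] {M : Type u} [AddCommGroup M]
    [Module R M] {N : ModuleCat.{u} R} (P : ProjectiveResolution N) (j : ℕ)
    (h : Subsingleton (((Tor (ModuleCat.{u} R) (j + 1)).obj (ModuleCat.of R M)).obj N)) :
    Function.Exact ((P.complex.d (j + 1 + 1) (j + 1)).hom.lTensor M)
      ((P.complex.d (j + 1) j).hom.lTensor M) := by
  have h1 : Limits.IsZero (((Tor (ModuleCat.{u} R) (j + 1)).obj (ModuleCat.of R M)).obj N) :=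
    ModuleCat.isZero_of_subsingleton _
  have h2 := h1.of_iso (P.isoLeftDerivedObj ((tensoringLeft _).obj (ModuleCat.of R M)) (j + 1)).symm
  have h3 := (HomologicalComplex.exactAt_iff_isZero_homology _ _).2 h2
  rw [HomologicalComplex.exactAt_iff' _ (j + 1 + 1) (j + 1) j (by simp) (by simp),
    ShortComplex.moduleCat_exact_iff_range_eq_ker] at h3
  rw [LinearMap.exact_iff]
  exact h3.symm

theorem exists_surjective_exact {R : Type u} [CommRing R] {N : ModuleCat.{u} R}
    (P : ProjectiveResolution N) : ∃ η : P.complex.X 0 →ₗ[R] N,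
      Function.Surjective η ∧ Function.Exact (P.complex.d 1 0).hom η := by
  let g : P.complex.X 0 ⟶ N := P.π.f 0
  have hg : Epi g := inferInstanceAs (Epi (P.π.f 0))
  have hdg : P.complex.d 1 0 ≫ g = 0 := P.complex_d_comp_π_f_zero
  have hex : (ShortComplex.mk (P.complex.d 1 0) g hdg).Exact := P.exact₀
  rw [ShortComplex.moduleCat_exact_iff_range_eq_ker] at hex
  exact ⟨g.hom, (ModuleCat.epi_iff_surjective g).1 hg, LinearMap.exact_iff.2 hex.symm⟩

theorem exact_rTensor_of_subsingleton_tor {R : Type u} [CommRing R] {M : Type u}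
    [AddCommGroup M] [Module R M] {N : ModuleCat.{u} R}
    (P : ProjectiveResolution N)
    {F : ℕ → Type u} [∀ i, AddCommGroup (F i)] [∀ i, Module R (F i)] [∀ i, Module.Flat R (F i)]
    {δ : ∀ i, F (i + 1) →ₗ[R] F i} {ε : F 0 →ₗ[R] M}
    (hδ : ∀ i, Function.Exact (δ (i + 1)) (δ i)) (hδε : Function.Exact (δ 0) ε)
    (hε : Function.Surjective ε) (j : ℕ)
    (h : Subsingleton (((Tor (ModuleCat.{u} R) (j + 1)).obj (ModuleCat.of R M)).obj N)) :
    Function.Exact ((δ (j + 1)).rTensor N) ((δ j).rTensor N) := by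
  have hflat (i : ℕ) : Module.Flat R (P.complex.X i) := by
    have := (IsProjective.iff_projective (R := R) (P.complex.X i)).2 (P.projective i)
    infer_instance
  obtain ⟨η, hη, hP₀⟩ := exists_surjective_exact P
  have hP (i : ℕ) : Function.Exact (P.complex.d (i + 1 + 1) (i + 1)).hom
      (P.complex.d (i + 1) i).hom := by
    have := P.exact_succ i
    rw [ShortComplex.moduleCat_exact_iff_range_eq_ker] at this
    exact LinearMap.exact_iff.2 this.symm
  exact exact_rTensor_of_exact_lTensor (P := fun i => P.complex.X i)
    (e := fun i => (P.complex.d (i + 1) i).hom) hP hP₀ hη j hδ hδε hε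
    (exact_lTensor_of_subsingleton_tor P j h)

section Frobenius

variable {R : Type u} [CommRing R]

open TensorProduct in
theorem exact_mulVec_of_exact_rTensor_frobMod (f : R →+* R) {a b c : ℕ}
    {g : (Fin a → R) →ₗ[R] (Fin b → R)} {h : (Fin b → R) →ₗ[R] (Fin c → R)}
    (hgh : Function.Exact (g.rTensor (frobMod f)) (h.rTensor (frobMod f))) :
    Function.Exact (g.toMatrix'.map f).mulVec (h.toMatrix'.map f).mulVec := by
  let Φ (n : ℕ) : (Fin n → R) ⊗[R] (frobMod f) ≃ₗ[R] (Fin n → frobMod f) :=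
    TensorProduct.comm R _ _ ≪≫ₗ piScalarRight R R (frobMod f) (Fin n)
  let Ψ (n : ℕ) : (Fin n → R) ⊗[R] (frobMod f) ≃+ (Fin n → R) := (Φ n).toAddEquiv
  have hΨ (n : ℕ) (v : Fin n → R) (x : R) :
      Ψ n (v ⊗ₜ[R] (show frobMod f from x)) = fun k => f (v k) * x := by
    ext k
    rfl
  have key : ∀ {a b : ℕ} (g : (Fin a → R) →ₗ[R] (Fin b → R)) (t : (Fin a → R) ⊗[R] (frobMod f)),
      Ψ b (g.rTensor (frobMod f) t) = (g.toMatrix'.map f).mulVec (Ψ a t) := by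
    intro a b g t
    induction t using TensorProduct.induction_on with
    | zero => simp
    | add x y hx hy => simp only [map_add, hx, hy, Matrix.mulVec_add]
    | tmul v x =>
      rw [LinearMap.rTensor_tmul]
      erw [hΨ, hΨ]
      ext k
      conv_lhs => rw [← LinearMap.toMatrix'_mulVec g v]
      simp only [Matrix.mulVec, dotProduct, map_sum, map_mul, Matrix.map_apply]
      exact (Finset.sum_mul _ _ _).trans (Finset.sum_congr rfl fun _ _ => mul_assoc _ _ _)
  intro x
  obtain ⟨t, rfl⟩ := (Ψ b).surjective x
  rw [← key, map_eq_zero_iff _ (Ψ c).injective, hgh t]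
  constructor
  · rintro ⟨s, rfl⟩
    exact ⟨Ψ a s, (key g s).symm⟩
  · rintro ⟨y, hy⟩
    obtain ⟨s, rfl⟩ := (Ψ a).surjective y
    exact ⟨s, (Ψ b).injective (by rw [key, hy])⟩

/-- The kernel of `B` modulo the ideal `I` is contained in the image of `A` modulo `I`. -/
def Matrix.ExactMod (I : Ideal R) {a b c : ℕ} (A : Matrix (Fin b) (Fin a) R)
    (B : Matrix (Fin c) (Fin b) R) : Prop :=
  ∀ x, (∀ k, B.mulVec x k ∈ I) → ∃ y, ∀ k, (x - A.mulVec y) k ∈ I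

theorem Matrix.ExactMod.sup_span_singleton {I : Ideal R} {r : R} (hr : ∀ x, r * x ∈ I → x ∈ I)
    {a b c d : ℕ} {A : Matrix (Fin b) (Fin a) R} {B : Matrix (Fin c) (Fin b) R}
    {C : Matrix (Fin d) (Fin c) R} (hCB : C * B = 0) (hAB : A.ExactMod I B) (hBC : B.ExactMod I C) :
    A.ExactMod (I ⊔ Ideal.span {r}) B := by
  have hmul {m n : ℕ} (T : Matrix (Fin m) (Fin n) R) (x : Fin n → R) (hx : ∀ k, x k ∈ I) (k) :
      T.mulVec x k ∈ I := by
    rw [Matrix.mulVec, dotProduct]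
    exact I.sum_mem fun i _ => I.mul_mem_left _ (hx i)
  intro x hx
  have : ∀ k, ∃ z, B.mulVec x k - r * z ∈ I := fun k => by
    obtain ⟨u, hu, v, hv, huv⟩ := Submodule.mem_sup.1 (hx k)
    obtain ⟨z, rfl⟩ := Ideal.mem_span_singleton'.1 hv
    exact ⟨z, by rwa [← huv, mul_comm r, add_sub_cancel_right]⟩
  choose z hz using this
  obtain ⟨w, hw⟩ := hBC z fun k => hr _ <| by
    have h := hmul C (B.mulVec x - r • z) hz k
    rw [Matrix.mulVec_sub, Matrix.mulVec_mulVec, hCB, Matrix.zero_mulVec, Matrix.mulVec_smul] at h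
    simpa using h
  obtain ⟨y, hy⟩ := hAB (x - r • w) fun k => by
    have h := I.add_mem (hz k) (I.mul_mem_left r (hw k))
    convert h using 1
    simp [Matrix.mulVec_sub, Matrix.mulVec_smul]
    ring
  refine ⟨y, fun k => ?_⟩
  have h := Submodule.add_mem_sup (hy k)
    (Ideal.mem_span_singleton'.2 ⟨w k, rfl⟩ : w k * r ∈ Ideal.span {r})
  convert h using 1
  simp
  ring

/-- Each element of a weakly regular sequence shortens the range of exactness by one degree. -/
theorem Matrix.exactMod_ofList_take {ys : List R}
    (hreg : RingTheory.Sequence.IsWeaklyRegular R ys) {a : ℕ → ℕ}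
    {D : ∀ i, Matrix (Fin (a i)) (Fin (a (i + 1))) R} (hDD : ∀ i, D i * D (i + 1) = 0) {n : ℕ}
    (hD : ∀ j, n ≤ j → j ≤ n + ys.length → Function.Exact (D (j + 1)).mulVec (D j).mulVec) :
    ∀ i ≤ ys.length, ∀ j, n + i ≤ j → j ≤ n + ys.length →
      (D (j + 1)).ExactMod (Ideal.ofList (ys.take i)) (D j) := by
  intro i
  induction i with
  | zero =>
    intro _ j hj hj' x hx
    obtain ⟨y, hy⟩ := (hD j hj hj' x).1 (funext fun k => by simpa using hx k)
    exact ⟨y, fun k => by simp [hy]⟩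
  | succ i ih =>
    intro hi j hj hj'
    obtain ⟨j, rfl⟩ : ∃ k, j = k + 1 := ⟨j - 1, by omega⟩
    have hr := hreg.regular_mod_prev i (by omega)
    rw [← List.take_concat_get' ys i (by omega), Ideal.ofList_append, Ideal.ofList_singleton]
    refine Matrix.ExactMod.sup_span_singleton (fun x hx => ?_) (hDD j)
      (ih (by omega) _ (by omega) hj') (ih (by omega) j (by omega) (by omega))
    have h0 := (isSMulRegular_iff_right_eq_zero_of_smul).1 hr (Submodule.Quotient.mk x) (by
      rw [← Submodule.Quotient.mk_smul, Submodule.Quotient.mk_eq_zero]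
      simpa using hx)
    rw [Submodule.Quotient.mk_eq_zero] at h0
    simpa using h0

theorem Matrix.ExactMod.eq_zero_of_mem_pow [IsLocalRing R] {I : Ideal R} {a b c e : ℕ}
    {A : Matrix (Fin b) (Fin a) R} {B : Matrix (Fin c) (Fin b) R} (h : A.ExactMod I B)
    (hA : ∀ i j, A i j ∈ IsLocalRing.maximalIdeal R ^ e)
    (hB : ∀ i j, B i j ∈ IsLocalRing.maximalIdeal R)
    (he : ¬ ((IsLocalRing.maximalIdeal R).map (Ideal.Quotient.mk I)).annihilator
      ≤ ((IsLocalRing.maximalIdeal R).map (Ideal.Quotient.mk I)) ^ e) : b = 0 := by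
  by_contra hb
  obtain ⟨s, hs, hse⟩ := SetLike.not_le_iff_exists.1 he
  obtain ⟨s, rfl⟩ := Ideal.Quotient.mk_surjective s
  let k : Fin b := ⟨0, Nat.pos_of_ne_zero hb⟩
  obtain ⟨y, hy⟩ := h (Pi.single k s) fun l => by
    rw [Matrix.mulVec_single]
    have := Submodule.mem_annihilator.1 hs _ (Ideal.mem_map_of_mem _ (hB l k))
    rw [smul_eq_mul, ← map_mul, Ideal.Quotient.eq_zero_iff_mem] at this
    simpa [mul_comm] using this
  apply hse
  have h1 := hy k
  rw [← Ideal.Quotient.eq_zero_iff_mem, Pi.sub_apply, Pi.single_eq_same, map_sub, sub_eq_zero] at h1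
  rw [h1, ← Ideal.map_pow]
  refine Ideal.mem_map_of_mem _ ?_
  rw [Matrix.mulVec, dotProduct]
  exact (Ideal.sum_mem _ fun i _ => Ideal.mul_mem_right _ _ (hA k i))

end Frobenius

/-- Let `(R, m)` be a Noetherian local commutative ring of prime
characteristic `p` with `depth R = d > 0`, let `y = y_1, …, y_d` be a maximal
`R`-regular sequence in `m`, and let `c = c_y(R)` be the smallest positive integer `s`
such that, in `R̄ = R/(y)` with maximal ideal `m̄`, the socle `(0 : m̄)_R̄` is not
contained in `m̄^s`.  Let `M` be a finitely generated `R`-module.  If for some `n ≥ 1`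
and some `r` with `p^r > c_y(R)` one has `Tor^R_j(M, ^{φ^r}R) = 0` for all
`n ≤ j ≤ n + d`, then `M` has finite projective dimension. -/
theorem stmt11 {R : Type u} [CommRing R] [IsNoetherianRing R] [IsLocalRing R]
    (p : ℕ) (hp : p.Prime) [CharP R p]
    (d : ℕ) (hd : 0 < d) (ys : List R) (hlen : ys.length = d)
    (hym : ∀ z ∈ ys, z ∈ IsLocalRing.maximalIdeal R)
    (hreg : RingTheory.Sequence.IsRegular R ys)
    (hmaximal : ∀ z ∈ IsLocalRing.maximalIdeal R,
      ¬ RingTheory.Sequence.IsRegular R (ys ++ [z]))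
    (c : ℕ) (hc0 : 0 < c)
    (hc : ¬ ((IsLocalRing.maximalIdeal R).map (Ideal.Quotient.mk (Ideal.ofList ys))).annihilator
      ≤ ((IsLocalRing.maximalIdeal R).map (Ideal.Quotient.mk (Ideal.ofList ys))) ^ c)
    (hcmin : ∀ s : ℕ, 0 < s → s < c →
      ((IsLocalRing.maximalIdeal R).map (Ideal.Quotient.mk (Ideal.ofList ys))).annihilator
        ≤ ((IsLocalRing.maximalIdeal R).map (Ideal.Quotient.mk (Ideal.ofList ys))) ^ s)
    (M : Type u) [AddCommGroup M] [Module R M] [Module.Finite R M]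
    (n r : ℕ) (hn : 1 ≤ n) (hr : c < p ^ r)
    (f : R →+* R) (hf : ∀ a, f a = a ^ p ^ r)
    (htor : ∀ j : ℕ, n ≤ j → j ≤ n + d →
      Subsingleton (((Tor (ModuleCat.{u} R) j).obj (ModuleCat.of R M)).obj (frobMod f))) :
    ∃ m : ℕ, HasProjDimLT R M m := by
  obtain ⟨a, δ, ε, hδ, hδε, hε, hδm⟩ := exists_minimal_resolution R M
  obtain ⟨Q, hQ⟩ := exists_projectiveResolution (F := fun i => Fin (a i) → R) hδ hδε hε
  have hpr : p ^ r ≠ 0 := by omega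
  have hfm : ∀ x ∈ IsLocalRing.maximalIdeal R, f x ∈ IsLocalRing.maximalIdeal R ^ c := fun x hx =>
    Ideal.pow_le_pow_right hr.le (by rw [hf]; exact Ideal.pow_mem_pow hx _)
  have hfm' : ∀ x ∈ IsLocalRing.maximalIdeal R, f x ∈ IsLocalRing.maximalIdeal R := fun x hx => by
    rw [hf]; exact Ideal.pow_mem_of_mem _ hx _ (Nat.pos_of_ne_zero hpr)
  let D (i : ℕ) : Matrix (Fin (a i)) (Fin (a (i + 1))) R := (δ i).toMatrix'.map f
  have hDD (i : ℕ) : D i * D (i + 1) = 0 := by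
    rw [← Matrix.map_mul, ← LinearMap.toMatrix'_comp, (hδ i).linearMap_comp_eq_zero, map_zero]
    exact Matrix.map_zero _ (map_zero f)
  have hD (j : ℕ) (h₁ : n - 1 ≤ j) (h₂ : j ≤ n - 1 + ys.length) :
      Function.Exact (D (j + 1)).mulVec (D j).mulVec :=
    exact_mulVec_of_exact_rTensor_frobMod f <|
      exact_rTensor_of_subsingleton_tor (F := fun i => Fin (a i) → R)
        (ProjectiveResolution.of _) hδ hδε hε j (htor (j + 1) (by omega) (by omega))
  have hmod := Matrix.exactMod_ofList_take hreg.toIsWeaklyRegular hDD hD ys.length le_rfl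
    (n - 1 + ys.length) le_rfl le_rfl
  rw [List.take_length] at hmod
  have hmem (i : ℕ) (k l) : (δ i).toMatrix' k l ∈ IsLocalRing.maximalIdeal R := by
    rw [LinearMap.toMatrix'_apply]; exact hδm i _ k
  have hzero := hmod.eq_zero_of_mem_pow (fun _ _ => hfm _ (hmem _ _ _))
    (fun _ _ => hfm' _ (hmem _ _ _)) hc
  refine ⟨n - 1 + ys.length + 1, Q, fun i hi => ?_⟩
  have ha : a i = 0 := by
    induction i, hi using Nat.le_induction with
    | base => exact hzero
    | succ i _ ih =>
      by_contra h
      let k : Fin (a (i + 1)) := ⟨0, Nat.pos_of_ne_zero h⟩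
      obtain ⟨y, hy⟩ := (hδ i (Pi.single k 1)).1 (funext fun l => (Fin.cast ih l).elim0)
      have := hδm (i + 1) y k
      rw [hy, Pi.single_eq_same] at this
      exact (Ideal.ne_top_iff_one _).1 (IsLocalRing.maximalIdeal.isMaximal R).ne_top this
  rw [hQ]
  have : IsEmpty (Fin (a i)) := by rw [ha]; infer_instance
  exact ModuleCat.isZero_of_subsingleton _
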